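/- Let (X,d) be a metric space. Then (X,d) is complete if and only if the metric space (F¹_USCG(X), H_end) is complete. -/

import Mathlib

open Set Filter Topology MeasureTheory
open scoped ENNReal NNReal

noncomputable section

/-- `sup_{a ∈ A} inf_{b ∈ B} ρ a b`, valued in `ℝ≥0∞`. -/
def hStar {Y : Type*} (ρ : Y → Y → ℝ≥0∞) (A B : Set Y) : ℝ≥0∞ :=
  ⨆ a ∈ A, ⨅ b ∈ B, ρ a b

/-- Hausdorff (extended) distance with respect to the distance `ρ`:
`H(A,B) = max (H*(A,B)) (H*(B,A))`. -/
def hDist {Y : Type*} (ρ : Y → Y → ℝ≥0∞) (A B : Set Y) : ℝ≥0∞ :=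
  max (hStar ρ A B) (hStar ρ B A)

/-- Kuratowski lower limit of a sequence of sets. -/
def KurLiminf {Y : Type*} [TopologicalSpace Y] (C : ℕ → Set Y) : Set Y :=
  {y | ∃ f : ℕ → Y, (∀ n, f n ∈ C n) ∧ Tendsto f atTop (𝓝 y)}

/-- Kuratowski upper limit of a sequence of sets. -/
def KurLimsup {Y : Type*} [TopologicalSpace Y] (C : ℕ → Set Y) : Set Y :=
  {y | ∃ φ : ℕ → ℕ, StrictMono φ ∧ ∃ f : ℕ → Y,
      (∀ k, f k ∈ C (φ k)) ∧ Tendsto f atTop (𝓝 y)}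

/-- Kuratowski convergence of a sequence of sets to a set. -/
def KurConv {Y : Type*} [TopologicalSpace Y] (C : ℕ → Set Y) (L : Set Y) : Prop :=
  KurLiminf C = L ∧ KurLimsup C = L

/-- A set `P` is dense in the set `S` (in particular `P ⊆ S`). -/
def DenseIn {Y : Type*} [TopologicalSpace Y] (P S : Set Y) : Prop :=
  P ⊆ S ∧ S ⊆ closure P

variable {X : Type*} [MetricSpace X]

/-- Hausdorff distance `H*` between subsets of the metric space `X`. -/
def HXstar (A B : Set X) : ℝ≥0∞ := hStar edist A B

/-- Hausdorff distance `H` between subsets of the metric space `X`. -/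
def HXdist (A B : Set X) : ℝ≥0∞ := hDist edist A B

/-- The metric `d̄` on `X × [0,1]` (modelled on `X × ℝ`):
`d̄((x,α),(y,β)) = d(x,y) + |α - β|`. -/
def dbar (p q : X × ℝ) : ℝ≥0∞ := edist p.1 q.1 + edist p.2 q.2

/-- `H*` for subsets of `(X × [0,1], d̄)`. -/
def HPstar (A B : Set (X × ℝ)) : ℝ≥0∞ := hStar dbar A B

/-- Hausdorff distance for subsets of `(X × [0,1], d̄)`. -/
def HPdist (A B : Set (X × ℝ)) : ℝ≥0∞ := hDist dbar A B

/-- The α-cut of a fuzzy set `u : X → ℝ`:  `[u]_α = {x | u x ≥ α}` for `α ≠ 0`, and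
`[u]_0 = closure {x | u x > 0}`. -/
def acut (u : X → ℝ) (α : ℝ) : Set X :=
  if α = 0 then closure {x | 0 < u x} else {x | α ≤ u x}

/-- The endograph of `u`: `{(x,t) ∈ X × [0,1] : u x ≥ t}`. -/
def endograph (u : X → ℝ) : Set (X × ℝ) :=
  {p : X × ℝ | p.2 ∈ Icc (0:ℝ) 1 ∧ p.2 ≤ u p.1}

/-- The sendograph of `u`: `end u ∩ ([u]_0 × [0,1])`. -/
def sendograph (u : X → ℝ) : Set (X × ℝ) :=
  endograph u ∩ ((acut u 0) ×ˢ (Icc (0:ℝ) 1))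

/-- `F¹_USC(X)`: normal upper semicontinuous fuzzy sets with values in `[0,1]`, i.e. all
α-cuts (`α ∈ [0,1]`) are nonempty and closed. -/
def FUSC (u : X → ℝ) : Prop :=
  (∀ x, u x ∈ Icc (0:ℝ) 1) ∧
    ∀ α ∈ Icc (0:ℝ) 1, (acut u α).Nonempty ∧ IsClosed (acut u α)

/-- `F¹_USCG(X)`: members of `F¹_USC(X)` whose α-cuts are compact for `α ∈ (0,1]`. -/
def FUSCG (u : X → ℝ) : Prop :=
  FUSC u ∧ ∀ α ∈ Ioc (0:ℝ) 1, IsCompact (acut u α)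

/-- `F¹_USCB(X)`: members of `F¹_USC(X)` whose 0-cut is compact. -/
def FUSCB (u : X → ℝ) : Prop :=
  FUSC u ∧ IsCompact (acut u 0)

/-- The endograph metric `H_end`. -/
def Hend (u v : X → ℝ) : ℝ≥0∞ := HPdist (endograph u) (endograph v)

/-- The sendograph metric `H_send`. -/
def Hsend (u v : X → ℝ) : ℝ≥0∞ := HPdist (sendograph u) (sendograph v)

/-- Γ-convergence: Kuratowski convergence of the endographs in `X × [0,1]`. -/
def GammaConv (un : ℕ → X → ℝ) (u : X → ℝ) : Prop :=
  KurConv (fun n => endograph (un n)) (endograph u)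

/-- `P(u)`: the set of `α ∈ (0,1)` such that `closure {u > α}` is a proper subset of `[u]_α`. -/
def Pset (u : X → ℝ) : Set ℝ :=
  {α ∈ Ioo (0:ℝ) 1 | closure {x | α < u x} ⊂ acut u α}

/-- `D(u)`: the set of `α ∈ (0,1)` such that `[u]_α ⊄ closure {u > α}`. -/
def Dset (u : X → ℝ) : Set ℝ :=
  {α ∈ Ioo (0:ℝ) 1 | ¬ acut u α ⊆ closure {x | α < u x}}

/-- `P₀(u) = (0,1) \ {α ∈ (0,1) : lim_{β → α} H([u]_β , [u]_α) = 0}`. -/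
def P0set (u : X → ℝ) : Set ℝ :=
  Ioo (0:ℝ) 1 \
    {α | Tendsto (fun β => HXdist (acut u β) (acut u α)) (𝓝[Icc (0:ℝ) 1] α) (𝓝 0)}

/-- The `d_p^*` distance on fuzzy sets. -/
def dpstar (p : ℝ) (u v : X → ℝ) : ℝ≥0∞ :=
  ⨅ f ∈ {f : ℝ → ℝ≥0∞ | Measurable f ∧
      ∀ α ∈ Icc (0:ℝ) 1, HXdist (acut u α) (acut v α) ≤ f α},
    (∫⁻ α in Icc (0:ℝ) 1, f α ^ p) ^ (1 / p)

theorem hDist_le {Y : Type*} {ρ : Y → Y → ℝ≥0∞} {A B : Set Y} {r : ℝ≥0∞}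
    (hA : ∀ a ∈ A, ∃ b ∈ B, ρ a b ≤ r) (hB : ∀ b ∈ B, ∃ a ∈ A, ρ b a ≤ r) :
    hDist ρ A B ≤ r := by
  refine max_le (iSup₂_le fun a ha => ?_) (iSup₂_le fun b hb => ?_)
  · obtain ⟨b, hb, h⟩ := hA a ha
    exact iInf₂_le_of_le b hb h
  · obtain ⟨a, ha, h⟩ := hB b hb
    exact iInf₂_le_of_le a ha h

theorem hDist_comm {Y : Type*} (ρ : Y → Y → ℝ≥0∞) (A B : Set Y) :
    hDist ρ A B = hDist ρ B A :=
  max_comm _ _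

theorem exists_lt_of_hDist_lt {Y : Type*} {ρ : Y → Y → ℝ≥0∞} {A B : Set Y} {r : ℝ≥0∞}
    (h : hDist ρ A B < r) {a : Y} (ha : a ∈ A) : ∃ b ∈ B, ρ a b < r := by
  have h' : ⨅ b ∈ B, ρ a b < r :=
    (le_iSup₂ (f := fun a (_ : a ∈ A) => ⨅ b ∈ B, ρ a b) a ha).trans_lt
      ((le_max_left _ _).trans_lt h)
  simpa only [iInf_lt_iff, exists_prop] using h'

theorem edist_le_dbar (p q : X × ℝ) : edist p q ≤ dbar p q := by
  rw [Prod.edist_eq]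
  exact max_le le_self_add le_add_self

theorem dbar_le_two_mul_edist (p q : X × ℝ) : dbar p q ≤ 2 * edist p q := by
  rw [Prod.edist_eq, two_mul]
  exact add_le_add (le_max_left _ _) (le_max_right _ _)

theorem hausdorffEDist_le_HPdist (A B : Set (X × ℝ)) :
    Metric.hausdorffEDist A B ≤ HPdist A B := by
  refine le_of_forall_gt fun r hr => ?_
  obtain ⟨r', hr', hrr'⟩ := exists_between hr
  refine lt_of_le_of_lt (Metric.hausdorffEDist_le_of_mem_edist ?_ ?_) hrr'
  · intro a ha
    obtain ⟨b, hb, h⟩ := exists_lt_of_hDist_lt hr' ha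
    exact ⟨b, hb, (edist_le_dbar a b).trans h.le⟩
  · intro b hb
    obtain ⟨a, ha, h⟩ := exists_lt_of_hDist_lt ((hDist_comm _ _ _).trans_lt hr') hb
    exact ⟨a, ha, (edist_le_dbar b a).trans h.le⟩

theorem HPdist_le_two_mul {A B : Set (X × ℝ)} {r : ℝ≥0∞}
    (h : Metric.hausdorffEDist A B < r) : HPdist A B ≤ 2 * r := by
  refine hDist_le ?_ ?_
  · intro a ha
    obtain ⟨b, hb, hab⟩ := Metric.exists_edist_lt_of_hausdorffEDist_lt ha h
    exact ⟨b, hb, (dbar_le_two_mul_edist a b).trans (by gcongr)⟩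
  · intro b hb
    rw [Metric.hausdorffEDist_comm] at h
    obtain ⟨a, ha, hab⟩ := Metric.exists_edist_lt_of_hausdorffEDist_lt hb h
    exact ⟨a, ha, (dbar_le_two_mul_edist b a).trans (by gcongr)⟩

/-- A closed subset of `X × [0,1]` containing `X × {0}` and downward closed in the second
coordinate is an endograph. -/
theorem exists_endograph_eq {K : Set (X × ℝ)} (hK : IsClosed K)
    (hsub : ∀ p ∈ K, p.2 ∈ Icc (0 : ℝ) 1) (hzero : ∀ x, (x, (0 : ℝ)) ∈ K)
    (hdown : ∀ x t r, (x, t) ∈ K → 0 ≤ r → r ≤ t → (x, r) ∈ K) :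
    ∃ v : X → ℝ, (∀ x, v x ∈ Icc (0 : ℝ) 1) ∧ endograph v = K := by
  have hbdd : ∀ x, BddAbove {t : ℝ | (x, t) ∈ K} := fun x => ⟨1, fun t ht => (hsub _ ht).2⟩
  have hmem : ∀ x, (x, sSup {t : ℝ | (x, t) ∈ K}) ∈ K := fun x =>
    IsClosed.csSup_mem (s := {t : ℝ | (x, t) ∈ K})
      (hK.preimage (f := fun t : ℝ => (x, t)) (by fun_prop)) ⟨0, hzero x⟩ (hbdd x)
  refine ⟨fun x => sSup {t : ℝ | (x, t) ∈ K}, fun x => hsub _ (hmem x), ?_⟩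
  ext ⟨x, t⟩
  exact ⟨fun h => hdown x _ t (hmem x) h.1.1 h.2,
    fun h => ⟨hsub _ h, le_csSup (hbdd x) h⟩⟩

/-- A fuzzy set all of whose positive cuts are compact and whose cuts below height one are
nonempty lies in `F¹_USCG(X)`. -/
theorem FUSCG_of_isCompact {v : X → ℝ} (hv : ∀ x, v x ∈ Icc (0 : ℝ) 1)
    (hc : ∀ α ∈ Ioc (0 : ℝ) 1, IsCompact {x | α ≤ v x})
    (hne : ∀ α ∈ Ioo (0 : ℝ) 1, {x | α ≤ v x}.Nonempty) : FUSCG v := by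
  have hcut : ∀ α ∈ Ioc (0 : ℝ) 1, acut v α = {x | α ≤ v x} := fun α hα =>
    if_neg hα.1.ne'
  obtain ⟨y, hy⟩ : ∃ y, 1 ≤ v y := by
    have hpos : ∀ n : ℕ, 1 - 1 / ((n : ℝ) + 2) ∈ Ioo (0 : ℝ) 1 := fun n => by
      have h2 : (0 : ℝ) < n + 2 := by positivity
      refine ⟨?_, by linarith [one_div_pos.2 h2]⟩
      rw [sub_pos, div_lt_one h2]
      linarith [(n.cast_nonneg : (0 : ℝ) ≤ n)]
    obtain ⟨y, hy⟩ := IsCompact.nonempty_iInter_of_sequence_nonempty_isCompact_isClosed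
      (fun n : ℕ => {x | 1 - 1 / ((n : ℝ) + 2) ≤ v x})
      (fun n x hx => by
        have h2 : 1 / (((n + 1 : ℕ) : ℝ) + 2) ≤ 1 / ((n : ℝ) + 2) := by
          gcongr
          simp
        have h1 : 1 - 1 / (((n + 1 : ℕ) : ℝ) + 2) ≤ v x := hx
        change 1 - 1 / ((n : ℝ) + 2) ≤ v x
        linarith)
      (fun n => hne _ (hpos n)) (hc _ (Ioo_subset_Ioc_self (hpos 0)))
      (fun n => (hc _ (Ioo_subset_Ioc_self (hpos n))).isClosed)
    refine ⟨y, le_of_forall_pos_lt_add fun ε hε => ?_⟩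
    obtain ⟨n, hn⟩ := exists_nat_one_div_lt hε
    have h1 : 1 - 1 / ((n : ℝ) + 2) ≤ v y := mem_iInter.1 hy n
    have h2 : 1 / ((n : ℝ) + 2) ≤ 1 / ((n : ℝ) + 1) := by
      gcongr
      norm_num
    linarith
  refine ⟨⟨hv, fun α hα => ?_⟩, fun α hα => hcut α hα ▸ hc α hα⟩
  rcases hα.1.eq_or_lt with rfl | h0
  · rw [acut, if_pos rfl]
    exact ⟨⟨y, subset_closure (zero_lt_one.trans_le hy)⟩, isClosed_closure⟩
  · rw [hcut α ⟨h0, hα.2⟩]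
    exact ⟨⟨y, hα.2.trans hy⟩, (hc α ⟨h0, hα.2⟩).isClosed⟩

theorem FUSC.exists_eq_one {u : X → ℝ} (hu : FUSC u) : ∃ y, u y = 1 := by
  obtain ⟨y, hy⟩ := (hu.2 1 ⟨zero_le_one, le_rfl⟩).1
  rw [acut, if_neg one_ne_zero] at hy
  exact ⟨y, le_antisymm (hu.1 y).2 hy⟩

/-- If the endograph of `v` is a Hausdorff limit of endographs of members of `F¹_USCG(X)`, then
the positive cuts of `v` are totally bounded. -/
theorem totallyBounded_of_endograph_approx {s : ℕ → X → ℝ} (hs : ∀ n, FUSCG (s n)) {v : X → ℝ}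
    (happ : ∀ ε > 0, ∃ n, ∀ p ∈ endograph v, ∃ q ∈ endograph (s n), dist p q < ε)
    {α : ℝ} (hα : α ∈ Ioc (0 : ℝ) 1) : TotallyBounded {x | α ≤ v x} := by
  rw [Metric.totallyBounded_iff]
  intro ε hε
  obtain ⟨n, hn⟩ := happ (min (ε / 2) (α / 2)) (lt_min (half_pos hε) (half_pos hα.1))
  have hα2 : α / 2 ∈ Ioc (0 : ℝ) 1 := ⟨half_pos hα.1, by linarith [hα.1, hα.2]⟩
  obtain ⟨t, ht, hcov⟩ :=
    Metric.totallyBounded_iff.1 ((hs n).2 _ hα2).totallyBounded (ε / 2) (half_pos hε)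
  refine ⟨t, ht, fun x hx => ?_⟩
  obtain ⟨⟨z, r⟩, hq, hd⟩ := hn (x, α) ⟨Ioc_subset_Icc_self hα, hx⟩
  rw [Prod.dist_eq, max_lt_iff, lt_min_iff, lt_min_iff, Real.dist_eq] at hd
  have hz : z ∈ acut (s n) (α / 2) := by
    rw [acut, if_neg hα2.1.ne']
    have h1 := (abs_lt.1 hd.2.2).2
    have h2 : r ≤ s n z := hq.2
    change α / 2 ≤ s n z
    dsimp only at h1
    linarith
  obtain ⟨c, hc, hzc⟩ := mem_iUnion₂.1 (hcov hz)
  refine mem_iUnion₂.2 ⟨c, hc, ?_⟩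
  calc dist x c ≤ dist x z + dist z c := dist_triangle _ _ _
    _ < ε / 2 + ε / 2 := add_lt_add hd.1.1 hzc
    _ = ε := add_halves ε

/-- A closed Hausdorff limit of endographs of members of `F¹_USCG(X)` is the endograph of a member
of `F¹_USCG(X)`. -/
theorem exists_FUSCG_endograph_eq [CompleteSpace X] {s : ℕ → X → ℝ} (hs : ∀ n, FUSCG (s n))
    {K : Set (X × ℝ)} (hK : IsClosed K)
    (happ : ∀ ε > 0, ∃ n, (∀ p ∈ K, ∃ q ∈ endograph (s n), dist p q < ε) ∧
      ∀ q ∈ endograph (s n), ∃ p ∈ K, dist q p < ε) :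
    ∃ v : X → ℝ, FUSCG v ∧ endograph v = K := by
  have hsub : ∀ p ∈ K, p.2 ∈ Icc (0 : ℝ) 1 := by
    intro p hp
    refine isClosed_Icc.closure_subset (Metric.mem_closure_iff.2 fun ε hε => ?_)
    obtain ⟨n, hn, -⟩ := happ ε hε
    obtain ⟨q, hq, hd⟩ := hn p hp
    exact ⟨q.2, hq.1, (le_max_right _ _).trans_lt hd⟩
  have hzero : ∀ x, (x, (0 : ℝ)) ∈ K := by
    intro x
    refine hK.closure_subset (Metric.mem_closure_iff.2 fun ε hε => ?_)
    obtain ⟨n, -, hn⟩ := happ ε hε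
    exact hn (x, 0) ⟨⟨le_rfl, zero_le_one⟩, ((hs n).1.1 x).1⟩
  have hdown : ∀ x t r, (x, t) ∈ K → 0 ≤ r → r ≤ t → (x, r) ∈ K := by
    intro x t r hxt hr hrt
    refine hK.closure_subset (Metric.mem_closure_iff.2 fun ε hε => ?_)
    obtain ⟨n, hn, hn'⟩ := happ (ε / 2) (half_pos hε)
    obtain ⟨⟨z, τ⟩, hq, hd⟩ := hn _ hxt
    rw [Prod.dist_eq, max_lt_iff, Real.dist_eq] at hd
    obtain ⟨p, hp, hqp⟩ := hn' (z, min τ r)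
      ⟨⟨le_min hq.1.1 hr, (min_le_left _ _).trans hq.1.2⟩, (min_le_left _ _).trans hq.2⟩
    refine ⟨p, hp, ?_⟩
    have h1 : dist (x, r) (z, min τ r) < ε / 2 := by
      rw [Prod.dist_eq, max_lt_iff, Real.dist_eq]
      refine ⟨hd.1, ?_⟩
      have h2 := abs_lt.1 hd.2
      dsimp only at h2 ⊢
      rcases min_cases τ r with ⟨h, h'⟩ | ⟨h, h'⟩ <;> rw [h, abs_lt] <;> constructor <;>
        linarith
    calc dist (x, r) p ≤ dist (x, r) (z, min τ r) + dist (z, min τ r) p := dist_triangle _ _ _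
      _ < ε / 2 + ε / 2 := add_lt_add h1 hqp
      _ = ε := add_halves ε
  obtain ⟨v, hv, rfl⟩ := exists_endograph_eq hK hsub hzero hdown
  refine ⟨v, FUSCG_of_isCompact hv (fun α hα => ?_) (fun α hα => ?_), rfl⟩
  · refine isCompact_iff_totallyBounded_isComplete.2 ⟨totallyBounded_of_endograph_approx hs
      (fun ε hε => (happ ε hε).imp fun n h => h.1) hα, IsClosed.isComplete ?_⟩
    have heq : {x | α ≤ v x} = (fun x => (x, α)) ⁻¹' endograph v := by
      ext x
      exact ⟨fun h => ⟨Ioc_subset_Icc_self hα, h⟩, fun h => h.2⟩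
    rw [heq]
    exact hK.preimage (by fun_prop)
  · obtain ⟨n, -, hn⟩ := happ (1 - α) (sub_pos.2 hα.2)
    obtain ⟨y, hy⟩ := (hs n).1.exists_eq_one
    obtain ⟨⟨x, t⟩, hp, hd⟩ := hn (y, 1) ⟨⟨zero_le_one, le_rfl⟩, hy.ge⟩
    rw [Prod.dist_eq, max_lt_iff, Real.dist_eq] at hd
    have h1 := (abs_lt.1 hd.2).2
    have h2 : t ≤ v x := hp.2
    refine ⟨x, ?_⟩
    change α ≤ v x
    dsimp only at h1
    linarith

/-- In a complete space, `H_end`-Cauchy sequences in `F¹_USCG(X)` converge. -/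
theorem exists_tendsto_Hend [CompleteSpace X] {s : ℕ → X → ℝ} (hs : ∀ n, FUSCG (s n))
    (hcau : ∀ ε : ℝ≥0∞, 0 < ε → ∃ N : ℕ, ∀ m ≥ N, ∀ n ≥ N, Hend (s m) (s n) < ε) :
    ∃ v : X → ℝ, FUSCG v ∧ Tendsto (fun n => Hend (s n) v) atTop (𝓝 0) := by
  let C : ℕ → TopologicalSpace.Closeds (X × ℝ) := fun n =>
    ⟨closure (endograph (s n)), isClosed_closure⟩
  have hC : CauchySeq C := by
    refine EMetric.cauchySeq_iff.2 fun ε hε => ?_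
    obtain ⟨N, hN⟩ := hcau ε hε
    refine ⟨N, fun m hm n hn => ?_⟩
    rw [TopologicalSpace.Closeds.edist_eq]
    change Metric.hausdorffEDist (closure _) (closure _) < ε
    rw [Metric.hausdorffEDist_closure]
    exact (hausdorffEDist_le_HPdist _ _).trans_lt (hN m hm n hn)
  obtain ⟨K, hK⟩ := cauchySeq_tendsto_of_complete hC
  have hlim : ∀ ε : ℝ≥0∞, 0 < ε → ∃ N, ∀ n ≥ N,
      Metric.hausdorffEDist (endograph (s n)) K < ε := by
    intro ε hε
    obtain ⟨N, hN⟩ := EMetric.tendsto_atTop.1 hK ε hε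
    refine ⟨N, fun n hn => ?_⟩
    rw [← Metric.hausdorffEDist_closure_left]
    exact hN n hn
  obtain ⟨v, hv, hvK⟩ := exists_FUSCG_endograph_eq hs K.isClosed fun ε hε => by
    obtain ⟨n, hn⟩ := hlim (ENNReal.ofReal ε) (ENNReal.ofReal_pos.2 hε)
    have hn := hn n le_rfl
    refine ⟨n, fun p hp => ?_, fun q hq => ?_⟩
    · rw [Metric.hausdorffEDist_comm] at hn
      obtain ⟨q, hq, h⟩ := Metric.exists_edist_lt_of_hausdorffEDist_lt hp hn
      exact ⟨q, hq, edist_lt_ofReal.1 h⟩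
    · obtain ⟨p, hp, h⟩ := Metric.exists_edist_lt_of_hausdorffEDist_lt hq hn
      exact ⟨p, hp, edist_lt_ofReal.1 h⟩
  refine ⟨v, hv, ENNReal.tendsto_atTop_zero.2 fun ε hε => ?_⟩
  obtain ⟨N, hN⟩ := hlim (ε / 2) (ENNReal.half_pos hε.ne')
  refine ⟨N, fun n hn => ?_⟩
  have h := HPdist_le_two_mul (hN n hn)
  rwa [← hvK, ENNReal.mul_div_cancel two_ne_zero ENNReal.ofNat_ne_top] at h

/-- The crisp fuzzy point at `a`. -/
def fuzzyPoint {Y : Type*} (a : Y) : Y → ℝ := indicator {a} 1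

theorem fuzzyPoint_self {Y : Type*} (a : Y) : fuzzyPoint a a = 1 := by simp [fuzzyPoint]

theorem fuzzyPoint_of_ne {Y : Type*} {a x : Y} (h : x ≠ a) : fuzzyPoint a x = 0 := by
  simp [fuzzyPoint, h]

theorem fuzzyPoint_mem_Icc {Y : Type*} (a x : Y) : fuzzyPoint a x ∈ Icc (0 : ℝ) 1 := by
  by_cases h : x = a
  · simp [h, fuzzyPoint_self]
  · simp [fuzzyPoint_of_ne h]

theorem FUSCG_fuzzyPoint (a : X) : FUSCG (fuzzyPoint a) := by
  have hcut : ∀ α ∈ Ioc (0 : ℝ) 1, {x | α ≤ fuzzyPoint a x} = {a} := by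
    intro α hα
    ext x
    by_cases h : x = a
    · simp [h, fuzzyPoint_self, hα.2]
    · simp [fuzzyPoint_of_ne h, h, hα.1]
  refine FUSCG_of_isCompact (fuzzyPoint_mem_Icc a) (fun α hα => ?_) (fun α hα => ?_)
  · rw [hcut α hα]
    exact isCompact_singleton
  · rw [hcut α (Ioo_subset_Ioc_self hα)]
    exact singleton_nonempty a

theorem Hend_fuzzyPoint_le (a b : X) : Hend (fuzzyPoint a) (fuzzyPoint b) ≤ edist a b := by
  have key : ∀ a b : X, ∀ p ∈ endograph (fuzzyPoint a), ∃ q ∈ endograph (fuzzyPoint b),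
      dbar p q ≤ edist a b := by
    rintro a b ⟨x, t⟩ ⟨ht, hx⟩
    by_cases h : x = a
    · subst h
      exact ⟨(b, t), ⟨ht, (fuzzyPoint_self b).symm ▸ ht.2⟩, by simp [dbar]⟩
    · rw [fuzzyPoint_of_ne h] at hx
      exact ⟨(x, t), ⟨ht, hx.trans (fuzzyPoint_mem_Icc b x).1⟩, by simp [dbar]⟩
  exact hDist_le (key a b) (edist_comm a b ▸ key b a)

theorem edist_lt_of_Hend_fuzzyPoint_lt {a y : X} {v : X → ℝ} (hy : v y = 1) {r : ℝ≥0∞}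
    (hr : r ≤ 1) (h : Hend (fuzzyPoint a) v < r) : edist a y < r := by
  obtain ⟨⟨x, t⟩, hq, hd⟩ := exists_lt_of_hDist_lt ((hDist_comm _ _ _).trans_lt h)
    (a := (y, (1 : ℝ))) ⟨⟨zero_le_one, le_rfl⟩, hy.ge⟩
  by_cases hx : x = a
  · subst hx
    rw [edist_comm]
    exact le_self_add.trans_lt hd
  · have ht : t = 0 := le_antisymm (hq.2.trans (fuzzyPoint_of_ne hx).le) hq.1.1
    have h1 : edist (1 : ℝ) t < 1 := (le_add_self.trans_lt hd).trans_le hr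
    simp [ht, edist_dist] at h1

/-- `(X,d)` is complete iff `(F¹_USCG(X), H_end)` is complete (every
`H_end`-Cauchy sequence in `F¹_USCG(X)` `H_end`-converges to an element of `F¹_USCG(X)`). -/
theorem stmt19 :
    CompleteSpace X ↔
      ∀ s : ℕ → X → ℝ, (∀ n, FUSCG (s n)) →
        (∀ ε : ℝ≥0∞, 0 < ε → ∃ N : ℕ, ∀ m ≥ N, ∀ n ≥ N, Hend (s m) (s n) < ε) →
        ∃ v : X → ℝ, FUSCG v ∧ Tendsto (fun n => Hend (s n) v) atTop (𝓝 0) := by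
  refine ⟨fun _ s hs hcau => exists_tendsto_Hend hs hcau, fun H => ?_⟩
  refine EMetric.complete_of_cauchySeq_tendsto fun a ha => ?_
  obtain ⟨v, hv, hlim⟩ := H (fun n => fuzzyPoint (a n)) (fun n => FUSCG_fuzzyPoint (a n))
    fun ε hε => by
      obtain ⟨N, hN⟩ := EMetric.cauchySeq_iff.1 ha ε hε
      exact ⟨N, fun m hm n hn => (Hend_fuzzyPoint_le _ _).trans_lt (hN m hm n hn)⟩
  obtain ⟨y, hy⟩ := hv.1.exists_eq_one
  refine ⟨y, EMetric.tendsto_nhds.2 fun ε hε => ?_⟩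
  filter_upwards [hlim.eventually (gt_mem_nhds (lt_min hε one_pos))] with n hn
  exact (edist_lt_of_Hend_fuzzyPoint_lt hy (min_le_right _ _) hn).trans_le (min_le_left _ _)

end
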